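/- For all positive integers m and n there exists a bijection A ↦ (S,U) from the set of all m×n ℙ-matrices onto the set of all pairs (S,U) of the same shape λ, where S is a marked tableau with entries among {1',1,…,n',n} and U is a semistandard tableau with entries among {1,…,m}, satisfying Σ_{i} |a_{ij}| = m_j(S), Σ_{j} |a_{ij}| = m_i(U) and mark(A) = mark(S), and which in addition satisfies: if A corresponds to a pair of shape λ = (λ_1, λ_2, …), then ℓ(A) = λ_1, i.e., the length of the longest increasing subsequence of the biword w_A equals the first part of λ. -/

import Mathlib

open scoped BigOperators

/-- An entry of a `ℙ`-matrix: either `0` or a letter `k` / `k'` (`k ≥ 1`),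
marked (`k'`) when the Bool is `true`. -/
inductive PEnt : Type where
  | zero : PEnt
  | letter : ℕ+ → Bool → PEnt
deriving DecidableEq

/-- `|a|`: the absolute value of an entry. -/
def PEnt.abs : PEnt → ℕ
  | .zero => 0
  | .letter k _ => k

/-- Whether an entry is marked. -/
def PEnt.isMarked : PEnt → Bool
  | .letter _ b => b
  | .zero => false

/-- `mark(A)`: number of marked entries of the matrix `A`. -/
def markMatrix {m n : ℕ} (A : Fin m → Fin n → PEnt) : ℕ :=
  (Finset.univ.filter fun p : Fin m × Fin n => (A p.1 p.2).isMarked = true).card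

/-- Letters of `ℙ` are encoded as naturals: the unmarked letter `k` as `2k` and the marked
letter `k'` as `2k - 1`; the order `1' < 1 < 2' < 2 < ⋯` becomes the order on codes. -/
def cellCodes (a : PEnt) (j : ℕ) : List ℕ :=
  match a with
  | .zero => []
  | .letter k false => List.replicate (k : ℕ) (2 * j)
  | .letter k true => (2 * j - 1) :: List.replicate ((k : ℕ) - 1) (2 * j)

/-- The lower line of the biword `w_A`: for each `(i,j)` in lexicographic order,
`|a_{ij}|` copies of the letter `j` (`1`-based), first one marked if `a_{ij}` is. -/
def lowerWord {m n : ℕ} (A : Fin m → Fin n → PEnt) : List ℕ :=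
  (List.finRange m).flatMap fun i =>
    (List.finRange n).flatMap fun j => cellCodes (A i j) ((j : ℕ) + 1)

/-- A word over `ℙ` (in code form) is increasing when it is weakly increasing and contains
each marked letter (odd code) at most once. -/
def IncrWord (l : List ℕ) : Prop :=
  l.Chain' (· ≤ ·) ∧ ∀ a : ℕ, a % 2 = 1 → l.count a ≤ 1

/-- `ℓ(A)`: the maximal length of an increasing subsequence of the lower line of `w_A`. -/
noncomputable def ellMatrix {m n : ℕ} (A : Fin m → Fin n → PEnt) : ℕ :=
  sSup {r : ℕ | ∃ l : List ℕ, l.Sublist (lowerWord A) ∧ IncrWord l ∧ l.length = r}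

/-- A marked tableau of shape `μ` (entries encoded as in `cellCodes`): weakly increasing
along rows and down columns, at most one `k'` per row (equal codes in a row are even) and
at most one `k` per column (equal codes in a column are odd); junk value `0` outside. -/
structure MarkedTableau (μ : YoungDiagram) where
  val : ℕ → ℕ → ℕ
  pos : ∀ i j, (i, j) ∈ μ → 1 ≤ val i j
  zeros : ∀ i j, (i, j) ∉ μ → val i j = 0
  rowWeak : ∀ i j1 j2, j1 ≤ j2 → (i, j2) ∈ μ → val i j1 ≤ val i j2
  colWeak : ∀ i1 i2 j, i1 ≤ i2 → (i2, j) ∈ μ → val i1 j ≤ val i2 j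
  rowMarked : ∀ i j1 j2, j1 < j2 → (i, j2) ∈ μ → val i j1 = val i j2 → val i j2 % 2 = 0
  colUnmarked : ∀ i1 i2 j, i1 < i2 → (i2, j) ∈ μ → val i1 j = val i2 j → val i2 j % 2 = 1

/-- `m_k(T)`: the number of entries of `T` equal to `k` or `k'`. -/
def mcount {μ : YoungDiagram} (T : MarkedTableau μ) (k : ℕ) : ℕ :=
  (μ.cells.filter fun c => T.val c.1 c.2 = 2 * k - 1 ∨ T.val c.1 c.2 = 2 * k).card

/-- `mark(T)`: the number of marked entries (odd codes) of `T`. -/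
def markTab {μ : YoungDiagram} (T : MarkedTableau μ) : ℕ :=
  (μ.cells.filter fun c => T.val c.1 c.2 % 2 = 1).card

/-- A pair `(S, U)` of tableaux of the same shape: `S` marked with entries among
`{1', 1, …, n', n}`, `U` semistandard (unmarked) with entries among `{1, …, m}`. -/
structure RSKPair (m n : ℕ) where
  shape : YoungDiagram
  S : MarkedTableau shape
  U : MarkedTableau shape
  hS : ∀ i j, (i, j) ∈ shape → S.val i j ≤ 2 * n
  hU : ∀ i j, (i, j) ∈ shape → U.val i j % 2 = 0 ∧ U.val i j ≤ 2 * m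

/-! ### Strips and the local rules of the growth diagram -/

/-- `μ / ν` is a horizontal strip (shapes are given by their row lengths). -/
def HStrip (ν μ : ℕ → ℕ) : Prop := ∀ k, ν k ≤ μ k ∧ μ (k + 1) ≤ ν k

/-- `μ / ν` is a vertical strip. -/
def VStrip (ν μ : ℕ → ℕ) : Prop := ∀ k, ν k ≤ μ k ∧ μ k ≤ ν k + 1

/-- `μ / ν` is a vertical strip when `b` is true, a horizontal strip otherwise. -/
def IsStrip (b : Bool) (ν μ : ℕ → ℕ) : Prop := if b then VStrip ν μ else HStrip ν μ

theorem IsStrip.le {b : Bool} {ν μ : ℕ → ℕ} (h : IsStrip b ν μ) (k : ℕ) : ν k ≤ μ k := by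
  cases b
  · exact (show HStrip ν μ from h) k |>.1
  · exact (show VStrip ν μ from h) k |>.1

theorem HStrip.antitone_right {ν μ : ℕ → ℕ} (h : HStrip ν μ) : Antitone μ :=
  antitone_nat_of_succ_le fun k => (h k).2.trans (h k).1

theorem HStrip.antitone_left {ν μ : ℕ → ℕ} (h : HStrip ν μ) : Antitone ν :=
  antitone_nat_of_succ_le fun k => (h (k + 1)).1.trans (h k).2

/-- The number of letters entering row `k` when the square with corners `ν, α, β` and
entry `a` is completed. -/
def carry (b : Bool) (ν α β : ℕ → ℕ) (a : ℕ) : ℕ → ℕ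
  | 0 => a
  | k + 1 => min (α k) (β k + if b then carry b ν α β a k else 0) - ν k

/-- The local rule of the growth diagram: the fourth corner of the square with corners
`ν, α, β` and entry `a`. -/
def localRule (b : Bool) (ν α β : ℕ → ℕ) (a : ℕ) (k : ℕ) : ℕ :=
  max (α k) (β k + if b then carry b ν α β a k else 0) + if b then 0 else carry b ν α β a k

/-- The carries of the local rule recovered from the corners `α, β, ρ`, in the row
`K - d`, where `K` bounds the number of rows. -/
def invCarryAux (b : Bool) (K : ℕ) (α β ρ : ℕ → ℕ) : ℕ → ℕ
  | 0 => 0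
  | d + 1 =>
    if b then
      if α (K - (d + 1)) ≤ β (K - (d + 1)) then ρ (K - (d + 1)) - β (K - (d + 1))
      else invCarryAux b K α β ρ d
    else ρ (K - (d + 1)) - max (α (K - (d + 1))) (β (K - (d + 1)))

/-- The carries of the local rule recovered from the corners `α, β, ρ`. -/
def invCarry (b : Bool) (K : ℕ) (α β ρ : ℕ → ℕ) (k : ℕ) : ℕ := invCarryAux b K α β ρ (K - k)

/-- The inverse local rule: the corner `ν` recovered from `α, β, ρ`. -/
def invRule (b : Bool) (K : ℕ) (α β ρ : ℕ → ℕ) (k : ℕ) : ℕ :=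
  min (α k) (β k + if b then invCarry b K α β ρ k else 0) - invCarry b K α β ρ (k + 1)

section LocalRule

variable {b : Bool} {K : ℕ} {ν α β ρ : ℕ → ℕ} {a : ℕ}

theorem carry_le_one (ha : a ≤ 1) (hα : VStrip ν α) (k : ℕ) :
    carry true ν α β a k ≤ 1 := by
  cases k with
  | zero => exact ha
  | succ k => have := hα k; simp only [carry]; omega

theorem hStrip_localRule (hα : IsStrip b ν α) (hβ : HStrip ν β) (hαa : Antitone α) :
    HStrip α (localRule b ν α β a) := by
  intro k
  have h1 := hα.le k
  have h2 := hβ k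
  have h4 : α (k + 1) ≤ α k := hαa (Nat.le_succ k)
  cases b
  · have h3 := (show HStrip ν α from hα) k
    simp only [localRule, carry]
    simp
    omega
  · simp only [localRule, carry]
    simp
    omega

theorem isStrip_localRule (hα : IsStrip b ν α) (hβ : HStrip ν β) (ha : b = true → a ≤ 1) :
    IsStrip b β (localRule b ν α β a) := by
  cases b
  · intro k
    have h2 := hβ k
    have h3 := (show HStrip ν α from hα) k
    simp only [localRule, carry]
    simp
    omega
  · intro k
    have h2 := hβ k
    have h3 := (show VStrip ν α from hα) k
    have h4 := carry_le_one (β := β) (ha rfl) hα k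
    simp only [localRule]
    simp
    omega

theorem invCarry_of_le {k : ℕ} (hk : K ≤ k) : invCarry b K α β ρ k = 0 := by
  simp [invCarry, Nat.sub_eq_zero_of_le hk, invCarryAux]

theorem invCarry_of_lt {k : ℕ} (hk : k < K) :
    invCarry b K α β ρ k =
      if b then if α k ≤ β k then ρ k - β k else invCarry b K α β ρ (k + 1)
      else ρ k - max (α k) (β k) := by
  obtain ⟨d, rfl⟩ : ∃ d, K = k + 1 + d := ⟨K - (k + 1), by omega⟩
  have h1 : k + 1 + d - k = d + 1 := by omega
  have h2 : k + 1 + d - (d + 1) = k := by omega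
  have h3 : k + 1 + d - (k + 1) = d := by omega
  simp only [invCarry, h1, h3, invCarryAux, h2]

theorem carry_le_localRule (k : ℕ) : carry b ν α β a k ≤ localRule b ν α β a k := by
  cases b <;> simp [localRule]

theorem invCarry_localRule (hα : IsStrip b ν α) (hβ : HStrip ν β) (ha : b = true → a ≤ 1)
    (hK : ∀ k, K ≤ k → localRule b ν α β a k = 0) (k : ℕ) :
    invCarry b K α β (localRule b ν α β a) k = carry b ν α β a k := by
  have base : ∀ k, K ≤ k →
      invCarry b K α β (localRule b ν α β a) k = carry b ν α β a k := fun k hk => by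
    rw [invCarry_of_le hk]
    have h1 := carry_le_localRule (b := b) (ν := ν) (α := α) (β := β) (a := a) k
    rw [hK k hk] at h1
    omega
  rcases le_total K k with hk | hk
  · exact base k hk
  · induction hk using Nat.decreasingInduction with
    | self => exact base K le_rfl
    | of_succ k hk ih =>
      rw [invCarry_of_lt hk, ih]
      cases b
      · simp [localRule]
      · have h1 := (show VStrip ν α from hα) k
        have h2 := hβ k
        have h3 := carry_le_one (β := β) (ha rfl) hα k
        simp only [localRule, carry]
        simp
        split_ifs <;> omega

theorem invRule_localRule (hα : IsStrip b ν α) (hβ : HStrip ν β) (ha : b = true → a ≤ 1)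
    (hK : ∀ k, K ≤ k → localRule b ν α β a k = 0) :
    invRule b K α β (localRule b ν α β a) = ν := by
  funext k
  have h1 := hα.le k
  have h2 := hβ k
  simp only [invRule, invCarry_localRule hα hβ ha hK, carry]
  cases b <;> simp <;> omega

theorem invCarry_le_one (hβ : VStrip β ρ) (k : ℕ) : invCarry true K α β ρ k ≤ 1 := by
  rcases le_total K k with hk | hk
  · simp [invCarry_of_le hk]
  · induction hk using Nat.decreasingInduction with
    | self => simp [invCarry_of_le le_rfl]
    | of_succ k hk ih =>
      have := hβ k
      rw [invCarry_of_lt hk]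
      simp
      split_ifs <;> omega

theorem add_invCarry_le (hα : HStrip α ρ) (hβ : IsStrip b β ρ) (k : ℕ) :
    (if b then β k else max (α k) (β k)) + invCarry b K α β ρ k ≤ ρ k := by
  have h1 := hα k
  have h2 := hβ.le k
  rcases le_or_gt K k with hk | hk
  · rw [invCarry_of_le hk]
    cases b <;> simp <;> omega
  · have h3 := invCarry_of_lt (b := b) (α := α) (β := β) (ρ := ρ) hk
    cases b
    · simp at h3 ⊢
      omega
    · have h4 := invCarry_le_one (K := K) (α := α) (show VStrip β ρ from hβ) k
      simp at h3 ⊢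
      split_ifs at h3 <;> omega

theorem hStrip_invRule (hα : HStrip α ρ) (hβ : IsStrip b β ρ) (hβa : Antitone β)
    (hK : ∀ k, K ≤ k → ρ k = 0) : HStrip (invRule b K α β ρ) β := by
  intro k
  have h1 := hα k
  have h2 := hβ.le k
  have h3 := add_invCarry_le (K := K) hα hβ (k + 1)
  have h4 : β (k + 1) ≤ β k := hβa (Nat.le_succ k)
  have h5 := hα (k + 1)
  cases b
  · have h6 := (show HStrip β ρ from hβ) k
    simp [invRule] at h3 ⊢
    omega
  · have h6 := (show VStrip β ρ from hβ) k
    have h7 := invCarry_le_one (K := K) (α := α) (show VStrip β ρ from hβ) k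
    rcases le_or_gt K k with hk | hk
    · have h8 := hK k hk
      have h9 := invCarry_of_le (b := true) (α := α) (β := β) (ρ := ρ) (Nat.le_succ_of_le hk)
      simp [invRule] at h3 h9 ⊢
      omega
    · have h8 := invCarry_of_lt (b := true) (α := α) (β := β) (ρ := ρ) hk
      simp [invRule] at h3 h8 ⊢
      split_ifs at h8 <;> omega

theorem isStrip_invRule (hα : HStrip α ρ) (hβ : IsStrip b β ρ)
    (hK : ∀ k, K ≤ k → ρ k = 0) : IsStrip b (invRule b K α β ρ) α := by
  cases b
  · intro k
    have h1 := hα k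
    have h3 := add_invCarry_le (K := K) hα hβ (k + 1)
    have h6 := (show HStrip β ρ from hβ) k
    simp [invRule] at h3 ⊢
    omega
  · intro k
    have h1 := hα k
    have h6 := (show VStrip β ρ from hβ) k
    have h7 := invCarry_le_one (K := K) (α := α) (show VStrip β ρ from hβ) k
    have h7' := invCarry_le_one (K := K) (α := α) (show VStrip β ρ from hβ) (k + 1)
    rcases le_or_gt K k with hk | hk
    · have h8 := hK k hk
      simp [invRule]
      omega
    · have h8 := invCarry_of_lt (b := true) (α := α) (β := β) (ρ := ρ) hk
      simp [invRule] at h8 ⊢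
      split_ifs at h8 <;> omega

theorem carry_invRule (hα : HStrip α ρ) (hβ : IsStrip b β ρ) (k : ℕ) :
    carry b (invRule b K α β ρ) α β (invCarry b K α β ρ 0) k = invCarry b K α β ρ k := by
  induction k with
  | zero => rfl
  | succ k ih =>
    have h1 := hα k
    have h3 := add_invCarry_le (K := K) hα hβ (k + 1)
    simp only [carry, ih, invRule]
    cases b
    · have h6 := (show HStrip β ρ from hβ) k
      simp at h3 ⊢
      omega
    · have h6 := (show VStrip β ρ from hβ) k
      rcases le_or_gt K k with hk | hk
      · have h9 := invCarry_of_le (b := true) (α := α) (β := β) (ρ := ρ) (Nat.le_succ_of_le hk)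
        simp at h9 ⊢
        omega
      · have h7' := invCarry_le_one (K := K) (α := α) (show VStrip β ρ from hβ) (k + 1)
        have h8 := invCarry_of_lt (b := true) (α := α) (β := β) (ρ := ρ) hk
        simp at h3 h8 ⊢
        split_ifs at h8 <;> omega

theorem localRule_invRule (hα : HStrip α ρ) (hβ : IsStrip b β ρ)
    (hK : ∀ k, K ≤ k → ρ k = 0) :
    localRule b (invRule b K α β ρ) α β (invCarry b K α β ρ 0) = ρ := by
  funext k
  have h1 := hα k
  simp only [localRule, carry_invRule hα hβ]
  rcases le_or_gt K k with hk | hk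
  · have h8 := hK k hk
    have h9 := invCarry_of_le (b := b) (α := α) (β := β) (ρ := ρ) hk
    have h6 := hβ.le k
    rw [h9]
    cases b <;> simp <;> omega
  · have h8 := invCarry_of_lt (b := b) (α := α) (β := β) (ρ := ρ) hk
    cases b
    · have h6 := (show HStrip β ρ from hβ) k
      simp at h8 ⊢
      omega
    · have h6 := (show VStrip β ρ from hβ) k
      have h7 := invCarry_le_one (K := K) (α := α) (show VStrip β ρ from hβ) k
      simp at h8 ⊢
      split_ifs at h8 <;> omega

theorem sum_localRule (hα : IsStrip b ν α) (hβ : HStrip ν β)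
    (hK : localRule b ν α β a K = 0) :
    ∑ k ∈ Finset.range K, localRule b ν α β a k + ∑ k ∈ Finset.range K, ν k =
      ∑ k ∈ Finset.range K, α k + ∑ k ∈ Finset.range K, β k + a := by
  have key : ∀ K, ∑ k ∈ Finset.range K, localRule b ν α β a k + ∑ k ∈ Finset.range K, ν k +
      carry b ν α β a K =
      ∑ k ∈ Finset.range K, α k + ∑ k ∈ Finset.range K, β k + a := by
    intro K
    induction K with
    | zero => simp [carry]
    | succ K ih =>
      have h1 := hα.le K
      have h2 := hβ K
      have h3 : localRule b ν α β a K + ν K + carry b ν α β a (K + 1) =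
          α K + β K + carry b ν α β a K := by
        cases b <;> simp [localRule, carry] <;> omega
      simp only [Finset.sum_range_succ]
      omega
  have h := carry_le_localRule (b := b) (ν := ν) (α := α) (β := β) (a := a) K
  have := key K
  omega

end LocalRule

/-! ### Growth diagrams -/

/-- Column `c` of a growth diagram carries the letter with code `c + 1`; this says whether
that letter is marked. -/
def markedCol (c : ℕ) : Bool := decide (c % 2 = 0)

/-- Marked columns have entries at most `1`. -/
def IsValid (x : ℕ → ℕ → ℕ) : Prop := ∀ i c, markedCol c = true → x i c ≤ 1

/-- The row of the growth diagram following the row `p`, for the row of entries `y`. -/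
def nextRow (p : ℕ → ℕ → ℕ) (y : ℕ → ℕ) : ℕ → ℕ → ℕ
  | 0 => 0
  | c + 1 => localRule (markedCol c) (p c) (p (c + 1)) (nextRow p y c) (y c)

/-- The growth diagram of the matrix `x`. -/
def growth (x : ℕ → ℕ → ℕ) : ℕ → ℕ → ℕ → ℕ
  | 0 => 0
  | i + 1 => nextRow (growth x i) (x i)

/-- A chain of shapes in which the step from `c` to `c + 1` adds the letter with
code `c + 1`. -/
structure IsShapeChain (f : ℕ → ℕ → ℕ) : Prop where
  zero : f 0 = 0
  anti : ∀ c, Antitone (f c)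
  step : ∀ c, IsStrip (markedCol c) (f c) (f (c + 1))

theorem IsShapeChain.mono {f : ℕ → ℕ → ℕ} (hf : IsShapeChain f) (k : ℕ) :
    Monotone fun c => f c k :=
  monotone_nat_of_le_succ fun c => (hf.step c).le k

theorem isShapeChain_zero : IsShapeChain 0 where
  zero := rfl
  anti _ _ _ _ := le_rfl
  step c := by
    cases h : markedCol c
    · exact fun k => ⟨le_rfl, le_rfl⟩
    · exact fun k => ⟨le_rfl, Nat.zero_le _⟩

theorem hStrip_nextRow {p : ℕ → ℕ → ℕ} {y : ℕ → ℕ} (hp : IsShapeChain p) (c : ℕ) :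
    HStrip (p c) (nextRow p y c) := by
  induction c with
  | zero => rw [hp.zero]; exact fun k => ⟨le_rfl, le_rfl⟩
  | succ c ih => exact hStrip_localRule (hp.step c) ih (hp.anti _)

theorem isShapeChain_nextRow {p : ℕ → ℕ → ℕ} {y : ℕ → ℕ} (hp : IsShapeChain p)
    (hy : ∀ c, markedCol c = true → y c ≤ 1) : IsShapeChain (nextRow p y) where
  zero := rfl
  anti c := (hStrip_nextRow hp c).antitone_right
  step c := isStrip_localRule (hp.step c) (hStrip_nextRow hp c) (hy c)

section Growth

variable {x : ℕ → ℕ → ℕ} (hx : IsValid x)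

include hx

theorem isShapeChain_growth (i : ℕ) : IsShapeChain (growth x i) := by
  induction i with
  | zero => exact isShapeChain_zero
  | succ i ih => exact isShapeChain_nextRow ih (hx i)

theorem hStrip_growth (i c : ℕ) : HStrip (growth x i c) (growth x (i + 1) c) :=
  hStrip_nextRow (isShapeChain_growth hx i) c

theorem growth_eq_zero {i k : ℕ} (c : ℕ) (hk : i ≤ k) : growth x i c k = 0 := by
  induction i generalizing k with
  | zero => rfl
  | succ i ih =>
    obtain ⟨k, rfl⟩ : ∃ j, k = j + 1 := ⟨k - 1, by omega⟩
    have := (hStrip_growth hx i c k).2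
    rw [ih (by omega : i ≤ k)] at this
    omega

theorem sum_growth {i K : ℕ} (hi : i ≤ K) (c : ℕ) :
    ∑ k ∈ Finset.range K, growth x i c k =
      ∑ r ∈ Finset.range i, ∑ d ∈ Finset.range c, x r d := by
  induction i generalizing c with
  | zero => simp [growth]
  | succ i ih =>
    induction c with
    | zero => simp [growth, nextRow]
    | succ c ihc =>
      have h := sum_localRule (K := K) (a := x i c) ((isShapeChain_growth hx i).step c)
        (hStrip_growth hx i c) (growth_eq_zero hx (c + 1) hi)
      have h1 := ih (by omega) c
      have h2 := ih (by omega) (c + 1)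
      change ∑ k ∈ Finset.range K, growth x (i + 1) (c + 1) k + _ = _ at h
      rw [Finset.sum_range_succ] at ihc ⊢
      rw [Finset.sum_range_succ (fun d => x i d)]
      omega

end Growth

theorem growth_congr {x y : ℕ → ℕ → ℕ} {i : ℕ} (h : ∀ r < i, x r = y r) :
    growth x i = growth y i := by
  induction i with
  | zero => rfl
  | succ i ih =>
    simp only [growth, h i (Nat.lt_succ_self i), ih fun r hr => h r (Nat.lt_succ_of_lt hr)]

theorem nextRow_injective {p q : ℕ → ℕ → ℕ} {y z : ℕ → ℕ} {N K : ℕ}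
    (hp : IsShapeChain p) (hq : IsShapeChain q)
    (hy : ∀ c, markedCol c = true → y c ≤ 1) (hz : ∀ c, markedCol c = true → z c ≤ 1)
    (hK : ∀ c k, K ≤ k → nextRow p y c k = 0)
    (hN : p N = q N) (h : ∀ c ≤ N, nextRow p y c = nextRow q z c) :
    (∀ c ≤ N, p c = q c) ∧ ∀ c < N, y c = z c := by
  have step : ∀ c < N, p (c + 1) = q (c + 1) → p c = q c ∧ y c = z c := by
    intro c hc e
    have h1 : localRule (markedCol c) (p c) (p (c + 1)) (nextRow p y c) (y c) =
        localRule (markedCol c) (q c) (q (c + 1)) (nextRow q z c) (z c) := h (c + 1) hc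
    have hq' := hK (c + 1)
    rw [h (c + 1) hc] at hq'
    have p1 := invRule_localRule (K := K) (hp.step c) (hStrip_nextRow hp c) (hy c)
      (hK (c + 1))
    have q1 := invRule_localRule (K := K) (hq.step c) (hStrip_nextRow hq c) (hz c) hq'
    have p2 := invCarry_localRule (K := K) (hp.step c) (hStrip_nextRow hp c) (hy c)
      (hK (c + 1)) 0
    have q2 := invCarry_localRule (K := K) (hq.step c) (hStrip_nextRow hq c) (hz c) hq' 0
    rw [h1, e, h c hc.le] at p1 p2
    exact ⟨p1.symm.trans q1, p2.symm.trans q2⟩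
  have hall : ∀ c ≤ N, p c = q c := by
    intro c hc
    induction hc using Nat.decreasingInduction with
    | self => exact hN
    | of_succ c hc ih => exact (step c hc ih).1
  exact ⟨hall, fun c hc => (step c hc (hall _ hc)).2⟩

theorem growth_injective {x y : ℕ → ℕ → ℕ} (hx : IsValid x) (hy : IsValid y) {M N : ℕ}
    (hS : ∀ c ≤ N, growth x M c = growth y M c) (hU : ∀ i ≤ M, growth x i N = growth y i N) :
    ∀ i < M, ∀ c < N, x i c = y i c := by
  induction M with
  | zero => intro i hi; omega
  | succ M ih =>
    have h := nextRow_injective (K := M + 1) (isShapeChain_growth hx M)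
      (isShapeChain_growth hy M) (hx M) (hy M) (fun c k hk => growth_eq_zero hx c hk)
      (hU M (Nat.le_succ M)) hS
    intro i hi c hc
    rcases Nat.lt_succ_iff_lt_or_eq.mp hi with hi | rfl
    · exact ih h.1 (fun i hi => hU i (by omega)) i hi c hc
    · exact h.2 c hc

/-- The row of the growth diagram preceding the row `t`, with right end `μ` in column `N`;
listed from right to left. -/
def prevRow (N K : ℕ) (t : ℕ → ℕ → ℕ) (μ : ℕ → ℕ) : ℕ → ℕ → ℕ
  | 0 => μ
  | d + 1 => invRule (markedCol (N - (d + 1))) K (prevRow N K t μ d) (t (N - (d + 1)))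
      (t (N - d))

theorem nextRow_surjective {t : ℕ → ℕ → ℕ} {μ : ℕ → ℕ} {N K : ℕ} (ht : IsShapeChain t)
    (hK : ∀ k, K ≤ k → t N k = 0) (hμ : HStrip μ (t N)) :
    ∃ p y, IsShapeChain p ∧ (∀ c, markedCol c = true → y c ≤ 1) ∧ (∀ c, N ≤ c → p c = μ) ∧
      ∀ c ≤ N, nextRow p y c = t c := by
  have hK' : ∀ c ≤ N, ∀ k, K ≤ k → t c k = 0 := fun c hc k hk =>
    Nat.le_zero.mp ((ht.mono k hc).trans_eq (hK k hk))
  set p : ℕ → ℕ → ℕ := fun c => prevRow N K t μ (N - c) with hp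
  have pN : ∀ c, N ≤ c → p c = μ := fun c hc => by
    simp [hp, Nat.sub_eq_zero_of_le hc, prevRow]
  have prec : ∀ c < N, p c = invRule (markedCol c) K (p (c + 1)) (t c) (t (c + 1)) := by
    intro c hc
    obtain ⟨d, rfl⟩ : ∃ d, N = c + 1 + d := ⟨N - (c + 1), by omega⟩
    have h1 : c + 1 + d - c = d + 1 := by omega
    have h2 : c + 1 + d - (d + 1) = c := by omega
    have h3 : c + 1 + d - (c + 1) = d := by omega
    have h4 : c + 1 + d - d = c + 1 := by omega
    simp only [hp, h1, h3, prevRow, h2, h4]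
  have pH : ∀ c ≤ N, HStrip (p c) (t c) := by
    intro c hc
    induction hc using Nat.decreasingInduction with
    | self => rw [pN N le_rfl]; exact hμ
    | of_succ c hc ih =>
      rw [prec c hc]
      exact hStrip_invRule ih (ht.step c) (ht.anti c) (hK' (c + 1) hc)
  have pS : IsShapeChain p := by
    refine ⟨?_, fun c => ?_, fun c => ?_⟩
    · funext k
      have := (pH 0 (Nat.zero_le N) k).1
      rw [ht.zero] at this
      exact Nat.le_zero.mp this
    · rcases le_total c N with hc | hc
      · exact (pH c hc).antitone_left
      · rw [pN c hc]; exact hμ.antitone_left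
    · rcases lt_or_ge c N with hc | hc
      · rw [prec c hc]
        exact isStrip_invRule (pH (c + 1) hc) (ht.step c) (hK' (c + 1) hc)
      · rw [pN c hc, pN (c + 1) (by omega)]
        cases markedCol c
        · exact fun k => ⟨le_rfl, hμ.antitone_left (Nat.le_succ k)⟩
        · exact fun k => ⟨le_rfl, Nat.le_succ _⟩
  refine ⟨p, fun c => if c < N then invCarry (markedCol c) K (p (c + 1)) (t c) (t (c + 1)) 0
    else 0, pS, fun c hc => ?_, pN, fun c hc => ?_⟩
  · dsimp only
    split_ifs with h
    · have := ht.step c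
      rw [hc] at this ⊢
      exact invCarry_le_one this 0
    · exact Nat.zero_le _
  · induction c with
    | zero => rw [ht.zero]; rfl
    | succ c ih =>
      rw [nextRow, ih (by omega), prec c hc, if_pos (by omega)]
      exact localRule_invRule (pH (c + 1) hc) (ht.step c) (hK' (c + 1) hc)

theorem growth_surjective {M N : ℕ} {s u : ℕ → ℕ → ℕ} (hs : IsShapeChain s) (hu0 : u 0 = 0)
    (hu : ∀ i < M, HStrip (u i) (u (i + 1))) (hsu : s N = u M) :
    ∃ x, IsValid x ∧ (∀ c ≤ N, growth x M c = s c) ∧ ∀ i ≤ M, growth x i N = u i := by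
  induction M generalizing s with
  | zero =>
    refine ⟨0, fun _ _ _ => Nat.zero_le _, fun c hc => ?_, fun i hi => ?_⟩
    · funext k
      have := hs.mono k hc
      simp only [hsu, hu0] at this
      exact (Nat.le_zero.mp this).symm
    · rw [Nat.le_zero.mp hi, hu0]; rfl
  | succ M ih =>
    have hsupp : ∀ i ≤ M + 1, ∀ k, i ≤ k → u i k = 0 := by
      intro i
      induction i with
      | zero => intro _ k _; rw [hu0]; rfl
      | succ i ihi =>
        intro hi k hk
        obtain ⟨k, rfl⟩ : ∃ j, k = j + 1 := ⟨k - 1, by omega⟩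
        have := (hu i (by omega) k).2
        rw [ihi (by omega) k (by omega)] at this
        omega
    obtain ⟨p, y, hp, hy, hpN, hpy⟩ := nextRow_surjective (N := N) (K := M + 1) (μ := u M) hs
      (by rw [hsu]; exact hsupp (M + 1) le_rfl) (by rw [hsu]; exact hu M (Nat.lt_succ_self M))
    obtain ⟨x, hx, hxs, hxu⟩ := ih hp (fun i hi => hu i (by omega)) (hpN N le_rfl)
    set x' : ℕ → ℕ → ℕ := fun i => if i < M then x i else y with hx'
    have hcongr : ∀ i ≤ M, growth x' i = growth x i := fun i hi =>
      growth_congr fun r hr => if_pos (by omega)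
    have hlast : ∀ c ≤ N, growth x' (M + 1) c = s c := by
      intro c hc
      rw [← hpy c hc]
      have hxM : x' M = y := if_neg (lt_irrefl M)
      rw [growth, hcongr M le_rfl, hxM]
      clear hxu
      induction c with
      | zero => rfl
      | succ c ihc =>
        rw [nextRow, nextRow, ihc (by omega), hxs c (by omega), hxs (c + 1) hc]
    refine ⟨x', fun i c hc => ?_, hlast, fun i hi => ?_⟩
    · simp only [hx']
      split_ifs
      · exact hx i c hc
      · exact hy c hc
    · rcases Nat.le_succ_iff.mp hi with hi | rfl
      · rw [hcongr i hi, hxu i hi]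
      · rw [hlast N le_rfl, hsu]

/-! ### Tableaux as chains of shapes -/

namespace MarkedTableau

theorem sInf_chain_le_iff {f : ℕ → ℕ → ℕ} (hf : IsShapeChain f) {N i j c : ℕ}
    (hj : j < f N i) : sInf {c | c ≤ N ∧ j < f c i} ≤ c ↔ j < f c i := by
  have hne : {c | c ≤ N ∧ j < f c i}.Nonempty := ⟨N, le_rfl, hj⟩
  constructor
  · intro h
    exact (Nat.sInf_mem hne).2.trans_le (hf.mono i h)
  · intro h
    rcases le_total c N with hc | hc
    · exact Nat.sInf_le ⟨hc, h⟩
    · exact (Nat.sInf_mem hne).1.trans hc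

/-- The tableau whose entries at most `c` form the shape `f c`, for every `c ≤ N`. -/
noncomputable def ofChain (μ : YoungDiagram) (f : ℕ → ℕ → ℕ) (hf : IsShapeChain f) (N : ℕ)
    (hμ : ∀ i j, (i, j) ∈ μ ↔ j < f N i) : MarkedTableau μ where
  val i j := sInf {c | c ≤ N ∧ j < f c i}
  pos i j h := by
    by_contra! hlt
    have := (sInf_chain_le_iff hf (c := 0) ((hμ i j).1 h)).1 (Nat.lt_succ_iff.mp hlt)
    rw [hf.zero] at this
    exact Nat.not_lt_zero _ this
  zeros i j h := by
    rw [hμ] at h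
    have : {c | c ≤ N ∧ j < f c i} = ∅ := by
      ext c
      simp only [Set.mem_ofPred_eq, Set.mem_empty_iff_false, iff_false, not_and]
      exact fun hc hlt => h (hlt.trans_le (hf.mono i hc))
    rw [this, Nat.sInf_empty]
  rowWeak i j1 j2 hj h := by
    rw [hμ] at h
    rw [sInf_chain_le_iff hf (hj.trans_lt h)]
    exact hj.trans_lt ((sInf_chain_le_iff hf h).1 le_rfl)
  colWeak i1 i2 j hi h := by
    rw [hμ] at h
    rw [sInf_chain_le_iff hf (h.trans_le (hf.anti N hi))]
    exact ((sInf_chain_le_iff hf h).1 le_rfl).trans_le (hf.anti _ hi)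
  rowMarked i j1 j2 hj h heq := by
    rw [hμ] at h
    by_contra hodd
    have h1 := (sInf_chain_le_iff hf h).1 le_rfl
    obtain ⟨d, hd⟩ : ∃ d, sInf {c | c ≤ N ∧ j2 < f c i} = d + 1 :=
      ⟨sInf {c | c ≤ N ∧ j2 < f c i} - 1, by omega⟩
    rw [hd] at heq h1 hodd
    have h2 := hf.step d
    rw [show markedCol d = true from decide_eq_true (by omega)] at h2
    have h3 := ((show VStrip _ _ from h2) i).2
    have h4 := (sInf_chain_le_iff hf (hj.trans h)).2 (show j1 < f d i by omega)
    omega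
  colUnmarked i1 i2 j hi h heq := by
    rw [hμ] at h
    by_contra heven
    have h1 := (sInf_chain_le_iff hf h).1 le_rfl
    have h0 : sInf {c | c ≤ N ∧ j < f c i2} ≠ 0 := fun h0 => by
      rw [h0, hf.zero] at h1
      exact Nat.not_lt_zero _ h1
    obtain ⟨d, hd⟩ : ∃ d, sInf {c | c ≤ N ∧ j < f c i2} = d + 1 :=
      ⟨sInf {c | c ≤ N ∧ j < f c i2} - 1, by omega⟩
    rw [hd] at heq h1 heven
    have h2 := hf.step d
    rw [show markedCol d = false from decide_eq_false (by omega)] at h2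
    have h3 := ((show HStrip _ _ from h2) i1).2
    have h5 : f (d + 1) i2 ≤ f (d + 1) (i1 + 1) := hf.anti _ hi
    have h4 := (sInf_chain_le_iff hf (h.trans_le (hf.anti N hi.le))).2
      (show j < f d i1 by omega)
    omega

theorem ofChain_val_le_iff {μ : YoungDiagram} {f : ℕ → ℕ → ℕ} {hf : IsShapeChain f} {N : ℕ}
    {hμ : ∀ i j, (i, j) ∈ μ ↔ j < f N i} {i j c : ℕ} (h : (i, j) ∈ μ) :
    (ofChain μ f hf N hμ).val i j ≤ c ↔ j < f c i :=
  sInf_chain_le_iff hf ((hμ i j).1 h)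

variable {μ : YoungDiagram} (T : MarkedTableau μ)

theorem exists_not_mem_or_lt_val (c i : ℕ) : ∃ j, ¬((i, j) ∈ μ ∧ T.val i j ≤ c) :=
  ⟨μ.rowLen i, fun h => lt_irrefl _ (YoungDiagram.mem_iff_lt_rowLen.1 h.1)⟩

open Classical in
/-- The row lengths of the shape formed by the entries at most `c` of a tableau. -/
noncomputable def toChain (c i : ℕ) : ℕ := Nat.find (T.exists_not_mem_or_lt_val c i)

theorem lt_toChain_iff {c i j : ℕ} : j < T.toChain c i ↔ (i, j) ∈ μ ∧ T.val i j ≤ c := by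
  classical
  rw [toChain, Nat.lt_find_iff]
  constructor
  · exact fun h => not_not.1 (h j le_rfl)
  · rintro ⟨h1, h2⟩ j' hj'
    exact not_not.2 ⟨μ.up_left_mem le_rfl hj' h1, (T.rowWeak i j' j hj' h1).trans h2⟩

theorem isShapeChain_toChain : IsShapeChain T.toChain where
  zero := by
    funext i
    by_contra h
    have h := T.lt_toChain_iff.1 (Nat.pos_of_ne_zero h)
    have := T.pos i 0 h.1
    omega
  anti c i i' hi := by
    refine le_of_forall_lt fun j hj => ?_
    rw [lt_toChain_iff] at hj ⊢
    exact ⟨μ.up_left_mem hi le_rfl hj.1, (T.colWeak i i' j hi hj.1).trans hj.2⟩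
  step c := by
    have mono : ∀ i, T.toChain c i ≤ T.toChain (c + 1) i := fun i => by
      refine le_of_forall_lt fun j hj => ?_
      rw [lt_toChain_iff] at hj ⊢
      exact ⟨hj.1, hj.2.trans (Nat.le_succ c)⟩
    by_cases hc : c % 2 = 0
    · rw [show markedCol c = true from decide_eq_true hc]
      refine fun i => ⟨mono i, ?_⟩
      by_contra! h
      have h1 := T.lt_toChain_iff.1 h
      have h2 := T.lt_toChain_iff.1 ((Nat.lt_succ_self (T.toChain c i)).trans h)
      have h3 := mt T.lt_toChain_iff.2 (lt_irrefl (T.toChain c i))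
      have h4 := T.rowWeak i _ _ (Nat.le_succ (T.toChain c i)) h1.1
      have h5 : ¬ T.val i (T.toChain c i) ≤ c := fun h => h3 ⟨h2.1, h⟩
      have h6 := T.rowMarked i _ _ (Nat.lt_succ_self (T.toChain c i)) h1.1
      simp only [Nat.succ_eq_add_one] at *
      omega
    · rw [show markedCol c = false from decide_eq_false hc]
      refine fun i => ⟨mono i, ?_⟩
      by_contra! h
      have h1 := T.lt_toChain_iff.1 h
      have h3 := mt T.lt_toChain_iff.2 (lt_irrefl (T.toChain c i))
      have h2 := μ.up_left_mem (Nat.le_succ i) le_rfl h1.1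
      have h4 := T.colWeak _ _ _ (Nat.le_succ i) h1.1
      have h5 : ¬ T.val i (T.toChain c i) ≤ c := fun h => h3 ⟨h2, h⟩
      have h6 := T.colUnmarked _ _ _ (Nat.lt_succ_self i) h1.1
      simp only [Nat.succ_eq_add_one] at *
      omega

theorem toChain_eq_rowLen {N : ℕ} (hN : ∀ i j, (i, j) ∈ μ → T.val i j ≤ N) (i : ℕ) :
    T.toChain N i = μ.rowLen i := by
  refine eq_of_forall_lt_iff fun j => ?_
  rw [lt_toChain_iff, ← YoungDiagram.mem_iff_lt_rowLen]
  exact and_iff_left_of_imp (hN i j)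

theorem val_ofChain_toChain {N : ℕ} {ν : YoungDiagram} {f : ℕ → ℕ → ℕ}
    {hf : IsShapeChain f} {hν : ∀ i j, (i, j) ∈ ν ↔ j < f N i}
    (hN : ∀ i j, (i, j) ∈ μ → T.val i j ≤ N) (h : ∀ c ≤ N, f c = T.toChain c) :
    (ofChain ν f hf N hν).val = T.val := by
  funext i j
  have hmem : (i, j) ∈ ν ↔ (i, j) ∈ μ := by
    rw [hν, h N le_rfl, lt_toChain_iff]
    exact and_iff_left_of_imp (hN i j)
  by_cases hij : (i, j) ∈ μ
  · have hij' := hmem.2 hij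
    have hle : (ofChain ν f hf N hν).val i j ≤ N := by
      rw [ofChain_val_le_iff hij']; exact (hν i j).1 hij'
    apply le_antisymm
    · rw [ofChain_val_le_iff hij', h _ (hN i j hij), lt_toChain_iff]
      exact ⟨hij, le_rfl⟩
    · have := (ofChain_val_le_iff (hf := hf) (hμ := hν) hij').1 le_rfl
      rw [h _ hle, lt_toChain_iff] at this
      exact this.2
  · rw [T.zeros i j hij, MarkedTableau.zeros _ i j (mt hmem.1 hij)]

theorem toChain_ofChain {N : ℕ} {f : ℕ → ℕ → ℕ} {hf : IsShapeChain f}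
    {hμ : ∀ i j, (i, j) ∈ μ ↔ j < f N i} {c : ℕ} (hc : c ≤ N) :
    (ofChain μ f hf N hμ).toChain c = f c := by
  funext i
  refine eq_of_forall_lt_iff fun j => ?_
  rw [lt_toChain_iff]
  constructor
  · rintro ⟨h1, h2⟩
    exact (ofChain_val_le_iff h1).1 h2
  · intro h
    have h1 := (hμ i j).2 (h.trans_le (hf.mono i hc))
    exact ⟨h1, (ofChain_val_le_iff h1).2 h⟩

theorem card_val_le {K : ℕ} (c : ℕ) (hK : ∀ k, K ≤ k → T.toChain c k = 0) :
    (μ.cells.filter fun p => T.val p.1 p.2 ≤ c).card =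
      ∑ k ∈ Finset.range K, T.toChain c k := by
  have h : (μ.cells.filter fun p => T.val p.1 p.2 ≤ c) =
      ((Finset.range K).sigma fun k => Finset.range (T.toChain c k)).map
        (Equiv.sigmaEquivProd ℕ ℕ).toEmbedding := by
    ext ⟨i, j⟩
    simp only [Finset.mem_filter, YoungDiagram.mem_cells, ← T.lt_toChain_iff, Finset.mem_map,
      Finset.mem_sigma, Finset.mem_range, Equiv.coe_toEmbedding, Equiv.sigmaEquivProd_apply,
      Sigma.exists, Prod.mk.injEq]
    constructor
    · intro hj
      refine ⟨i, j, ⟨?_, hj⟩, rfl, rfl⟩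
      by_contra! hi
      rw [hK i hi] at hj
      exact Nat.not_lt_zero _ hj
    · rintro ⟨_, _, ⟨_, hj⟩, rfl, rfl⟩
      exact hj
  rw [h, Finset.card_map, Finset.card_sigma]
  simp

theorem card_val_le_add_card_val_eq (c : ℕ) :
    (μ.cells.filter fun p => T.val p.1 p.2 ≤ c).card +
      (μ.cells.filter fun p => T.val p.1 p.2 = c + 1).card =
      (μ.cells.filter fun p => T.val p.1 p.2 ≤ c + 1).card := by
  rw [← Finset.card_union_of_disjoint, ← Finset.filter_or]
  · congr 1
    refine Finset.filter_congr fun p _ => ?_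
    omega
  · refine Finset.disjoint_filter.2 fun p _ => ?_
    omega

theorem mcount_succ (j : ℕ) :
    mcount T (j + 1) = (μ.cells.filter fun p => T.val p.1 p.2 = 2 * j + 1).card +
      (μ.cells.filter fun p => T.val p.1 p.2 = 2 * j + 1 + 1).card := by
  rw [← Finset.card_union_of_disjoint, ← Finset.filter_or]
  · rfl
  · refine Finset.disjoint_filter.2 fun p _ => ?_
    omega

theorem markTab_eq_sum {n : ℕ} (hT : ∀ i j, (i, j) ∈ μ → T.val i j ≤ 2 * n) :
    markTab T = ∑ j ∈ Finset.range n,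
      (μ.cells.filter fun p => T.val p.1 p.2 = 2 * j + 1).card := by
  rw [markTab, Finset.card_eq_sum_card_fiberwise (f := fun p => T.val p.1 p.2 / 2)
    (t := Finset.range n)]
  · refine Finset.sum_congr rfl fun j _ => ?_
    rw [Finset.filter_filter]
    congr 1
    refine Finset.filter_congr fun p _ => ?_
    omega
  · intro p hp
    simp only [Finset.coe_filter, YoungDiagram.mem_cells, Set.mem_ofPred_eq] at hp
    have := hT p.1 p.2 hp.1
    simp only [Finset.coe_range, Set.mem_Iio]
    omega

end MarkedTableau

/-- The Young diagram with row lengths `r`, restricted to the first `K` rows. -/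
def diagram (r : ℕ → ℕ) (hr : Antitone r) (K : ℕ) : YoungDiagram where
  cells := (Finset.range K ×ˢ Finset.range (r 0)).filter fun p => p.2 < r p.1
  isLowerSet := by
    rintro ⟨i, j⟩ ⟨i', j'⟩ ⟨hi, hj⟩ h
    simp only [Finset.coe_filter, Finset.mem_product, Finset.mem_range,
      Set.mem_ofPred_eq] at h hi hj ⊢
    have := hr hi
    omega

theorem mem_diagram {r : ℕ → ℕ} {hr : Antitone r} {K : ℕ} (hK : ∀ k, K ≤ k → r k = 0)
    {i j : ℕ} : (i, j) ∈ diagram r hr K ↔ j < r i := by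
  rw [← YoungDiagram.mem_cells]
  simp only [diagram, Finset.mem_filter, Finset.mem_product, Finset.mem_range]
  refine and_iff_right_of_imp fun h => ⟨?_, h.trans_le (hr (Nat.zero_le i))⟩
  by_contra! hi
  rw [hK i hi] at h
  exact Nat.not_lt_zero _ h

theorem RSKPair.ext_val {m n : ℕ} {P Q : RSKPair m n} (hS : P.S.val = Q.S.val)
    (hU : P.U.val = Q.U.val) : P = Q := by
  have key : ∀ (P : RSKPair m n) (i j : ℕ), (i, j) ∈ P.shape ↔ 1 ≤ P.S.val i j :=
    fun P i j => ⟨P.S.pos i j, fun h => by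
      by_contra hij
      rw [P.S.zeros i j hij] at h
      omega⟩
  have hshape : P.shape = Q.shape := by
    ext ⟨i, j⟩
    rw [YoungDiagram.mem_cells, YoungDiagram.mem_cells, key, key, hS]
  obtain ⟨μ, S, U, _, _⟩ := P
  obtain ⟨ν, S', U', _, _⟩ := Q
  obtain rfl : μ = ν := hshape
  cases S; cases S'; cases U; cases U'
  simp only at hS hU
  subst hS hU
  rfl

/-! ### Increasing subsequences and the first row -/

/-- The relation between a letter code and a later one in an increasing word. -/
def CodeLE (a b : ℕ) : Prop := a < b ∨ a = b ∧ a % 2 = 0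

theorem pairwise_le_and_count_iff (l : List ℕ) :
    (l.Pairwise (· ≤ ·) ∧ ∀ a : ℕ, a % 2 = 1 → l.count a ≤ 1) ↔ l.Pairwise CodeLE := by
  induction l with
  | nil => simp
  | cons b l ih =>
    rw [List.pairwise_cons, List.pairwise_cons, ← ih]
    constructor
    · rintro ⟨⟨h1, h2⟩, h3⟩
      refine ⟨fun a ha => ?_, h2, fun a ha => (List.count_le_count_cons).trans (h3 a ha)⟩
      rcases (h1 a ha).lt_or_eq with h | rfl
      · exact Or.inl h
      · refine Or.inr ⟨rfl, ?_⟩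
        by_contra hodd
        have h4 := h3 b (by omega)
        rw [List.count_cons_self] at h4
        have := List.count_pos_iff.2 ha
        omega
    · rintro ⟨h1, h2, h3⟩
      refine ⟨⟨fun a ha => ?_, h2⟩, fun a ha => ?_⟩
      · rcases h1 a ha with h | h
        · exact h.le
        · exact h.1.le
      · rw [List.count_cons]
        split_ifs with hab
        · obtain rfl : b = a := by simpa using hab
          have : l.count b = 0 := List.count_eq_zero.2 fun hb => by
            rcases h1 b hb with h | h <;> omega
          omega
        · exact h3 a ha

theorem incrWord_iff_pairwise (l : List ℕ) : IncrWord l ↔ l.Pairwise CodeLE := by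
  rw [← pairwise_le_and_count_iff, ← List.isChain_iff_pairwise]
  rfl

/-- The word of a row of entries: `y c` copies of the letter code `c + 1` for each `c < N`. -/
def rowWord (y : ℕ → ℕ) : ℕ → List ℕ
  | 0 => []
  | c + 1 => rowWord y c ++ List.replicate (y c) (c + 1)

/-- The concatenation of the words of the first rows of a matrix with `N` columns. -/
def matrixWord (x : ℕ → ℕ → ℕ) (N : ℕ) : ℕ → List ℕ
  | 0 => []
  | i + 1 => matrixWord x N i ++ rowWord (x i) N

theorem mem_rowWord {y : ℕ → ℕ} {N a : ℕ} (h : a ∈ rowWord y N) : 1 ≤ a ∧ a ≤ N := by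
  induction N with
  | zero => simp [rowWord] at h
  | succ N ih =>
    rcases List.mem_append.1 h with h | h
    · have := ih h; omega
    · have := List.eq_of_mem_replicate h; omega

theorem pos_of_mem_matrixWord {x : ℕ → ℕ → ℕ} {N i a : ℕ} (h : a ∈ matrixWord x N i) :
    1 ≤ a := by
  induction i with
  | zero => simp [matrixWord] at h
  | succ i ih =>
    rcases List.mem_append.1 h with h | h
    · exact ih h
    · exact (mem_rowWord h).1

theorem rowWord_sublist (y : ℕ → ℕ) {c N : ℕ} (h : c ≤ N) :
    (rowWord y c).Sublist (rowWord y N) := by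
  induction N, h using Nat.le_induction with
  | base => exact List.Sublist.refl _
  | succ N _ ih => exact ih.trans (List.sublist_append_left _ _)

theorem sublist_rowWord_of_le {y : ℕ → ℕ} {c N : ℕ} (h : c ≤ N) {l : List ℕ}
    (hl : l.Sublist (rowWord y N)) (hle : ∀ a ∈ l, a ≤ c) : l.Sublist (rowWord y c) := by
  induction N, h using Nat.le_induction with
  | base => exact hl
  | succ N hN ih =>
    obtain ⟨l1, l2, rfl, h1, h2⟩ := List.sublist_append_iff.1 hl
    have : l2 = [] := List.eq_nil_iff_forall_not_mem.2 fun a ha => by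
      have h3 := List.eq_of_mem_replicate (h2.subset ha)
      have h4 := hle a (List.mem_append_right _ ha)
      omega
    subst this
    exact ih (by rwa [List.append_nil])

section FirstRow

variable {x : ℕ → ℕ → ℕ}

theorem growth_succ_succ_first (i c : ℕ) :
    growth x (i + 1) (c + 1) 0 = max (growth x i (c + 1) 0)
      (growth x (i + 1) c 0 + if markedCol c then x i c else 0) +
        if markedCol c then 0 else x i c := rfl

theorem length_le_growth (hx : IsValid x) {N : ℕ} (i : ℕ) {c : ℕ} (hc : c ≤ N) {l : List ℕ}
    (hl : l.Sublist (matrixWord x N i)) (hp : l.Pairwise CodeLE) (hle : ∀ a ∈ l, a ≤ c) :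
    l.length ≤ growth x i c 0 := by
  induction i generalizing c l with
  | zero =>
    rw [List.sublist_nil.1 hl]
    exact Nat.zero_le _
  | succ i ih =>
    obtain ⟨l1, l2, rfl, h1, h2⟩ := List.sublist_append_iff.1 hl
    replace h2 := sublist_rowWord_of_le hc h2 fun a ha => hle a (List.mem_append_right _ ha)
    clear hl
    induction c generalizing l2 with
    | zero =>
      have h3 : l1 ++ l2 = [] := List.eq_nil_iff_forall_not_mem.2 fun a ha => by
        have h4 := hle a ha
        rcases List.mem_append.1 ha with h | h
        · have := pos_of_mem_matrixWord (h1.subset h); omega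
        · have := mem_rowWord (h2.subset h); omega
      rw [h3]
      exact Nat.zero_le _
    | succ c ihc =>
      obtain ⟨l3, l4, rfl, h3, h4⟩ := List.sublist_append_iff.1 h2
      obtain ⟨r, hr, rfl⟩ := List.sublist_replicate_iff.1 h4
      rw [← List.append_assoc] at hp hle ⊢
      obtain ⟨hp1, -, hp2⟩ := List.pairwise_append.1 hp
      have hle1 : ∀ a ∈ l1 ++ l3, a ≤ c + 1 := fun a ha => hle a (List.mem_append_left _ ha)
      have small : (∀ a ∈ l1 ++ l3, a ≤ c) →
          (l1 ++ l3).length ≤ growth x (i + 1) c 0 := fun h =>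
        ihc (by omega) l3 hp1 h h3
      have big : l3 = [] → (l1 ++ l3).length ≤ growth x i (c + 1) 0 := by
        rintro rfl
        rw [List.append_nil] at hp1 hle1 ⊢
        exact ih hc h1 hp1 hle1
      have alt : l3 = [] ∨ ∀ a ∈ l1 ++ l3, a ≤ c := by
        refine or_iff_not_imp_left.2 fun hne a ha => ?_
        rcases List.mem_append.1 ha with h | h
        · obtain ⟨b, hb⟩ := List.exists_mem_of_ne_nil _ hne
          have h5 := (mem_rowWord (h3.subset hb)).2
          rcases (List.pairwise_append.1 hp1).2.2 a h b hb with h6 | h6 <;> omega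
        · exact (mem_rowWord (h3.subset h)).2
      rw [growth_succ_succ_first, List.length_append, List.length_replicate]
      cases hb : markedCol c
      · simp only [Bool.false_eq_true, if_false, add_zero]
        rcases alt with h | h
        · have := big h; omega
        · have := small h; omega
      · have hxc := hx i c hb
        simp only [if_true, add_zero]
        rcases Nat.eq_zero_or_pos r with rfl | hr0
        · rcases alt with h | h
          · have := big h; omega
          · have := small h; omega
        · have h := small fun a ha => by
            have hodd : c % 2 = 0 := of_decide_eq_true hb
            rcases hp2 a ha (c + 1) (List.mem_replicate.2 ⟨hr0.ne', rfl⟩) with h | h <;> omega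
          omega

theorem exists_sublist_length_eq_growth (hx : IsValid x) {N : ℕ} (i : ℕ) {c : ℕ}
    (hc : c ≤ N) : ∃ l : List ℕ, l.Sublist (matrixWord x N i) ∧ l.Pairwise CodeLE ∧
      (∀ a ∈ l, a ≤ c) ∧ l.length = growth x i c 0 := by
  induction i generalizing c with
  | zero => exact ⟨[], by simp, by simp, by simp, rfl⟩
  | succ i ih =>
    suffices h : ∃ l : List ℕ, l.Sublist (matrixWord x N i ++ rowWord (x i) c) ∧
        l.Pairwise CodeLE ∧ (∀ a ∈ l, a ≤ c) ∧ l.length = growth x (i + 1) c 0 by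
      obtain ⟨l, h1, h2⟩ := h
      exact ⟨l, h1.trans ((rowWord_sublist _ hc).append_left _), h2⟩
    induction c with
    | zero => exact ⟨[], by simp, by simp, by simp, rfl⟩
    | succ c ihc =>
      obtain ⟨l, hl, hlp, hlc, hll⟩ := ih hc
      obtain ⟨l', hl', hlp', hlc', hll'⟩ := ihc (by omega)
      have sub : ∀ {k : List ℕ}, k.Sublist (matrixWord x N i ++ rowWord (x i) c) →
          (k ++ List.replicate (x i c) (c + 1)).Sublist
            (matrixWord x N i ++ rowWord (x i) (c + 1)) := fun h => by
        rw [rowWord, ← List.append_assoc]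
        exact h.append_right _
      have hle : ∀ {k : List ℕ}, (∀ a ∈ k, a ≤ c + 1) →
          ∀ a ∈ k ++ List.replicate (x i c) (c + 1), a ≤ c + 1 := fun h a ha => by
        rcases List.mem_append.1 ha with ha | ha
        · exact h a ha
        · exact (List.eq_of_mem_replicate ha).le
      have up : ∀ a ∈ l', a ≤ c + 1 := fun a ha => (hlc' a ha).trans (Nat.le_succ c)
      have pw : (l' ++ List.replicate (x i c) (c + 1)).Pairwise CodeLE := by
        refine List.pairwise_append.2 ⟨hlp', ?_, fun a ha b hb => ?_⟩
        · rw [List.pairwise_replicate]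
          cases hb : markedCol c
          · have : ¬ c % 2 = 0 := of_decide_eq_false hb
            exact Or.inr (Or.inr ⟨rfl, by omega⟩)
          · exact Or.inl (hx i c hb)
        · rw [List.eq_of_mem_replicate hb]
          exact Or.inl (Nat.lt_succ_of_le (hlc' a ha))
      rw [growth_succ_succ_first]
      cases hb : markedCol c
      · simp only [Bool.false_eq_true, if_false, add_zero]
        rcases le_total (growth x i (c + 1) 0) (growth x (i + 1) c 0) with h | h
        · exact ⟨_, sub hl', pw, hle up, by simp [hll', max_eq_right h]⟩
        · refine ⟨_, sub (hl.trans (List.sublist_append_left _ _)), ?_, hle hlc,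
            by simp [hll, max_eq_left h]⟩
          have hne : ¬ c % 2 = 0 := of_decide_eq_false hb
          refine List.pairwise_append.2 ⟨hlp, ?_, fun a ha b hb => ?_⟩
          · rw [List.pairwise_replicate]
            exact Or.inr (Or.inr ⟨rfl, by omega⟩)
          · rw [List.eq_of_mem_replicate hb]
            have := hlc a ha
            unfold CodeLE
            omega
      · simp only [if_true, add_zero]
        rcases le_total (growth x i (c + 1) 0) (growth x (i + 1) c 0 + x i c) with h | h
        · exact ⟨_, sub hl', pw, hle up, by simp [hll', max_eq_right h]⟩
        · exact ⟨l, hl.trans (List.sublist_append_left _ _), hlp, hlc,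
            by rw [hll, max_eq_left h]⟩

theorem sSup_length_eq_growth (hx : IsValid x) (m N : ℕ) :
    sSup {r : ℕ | ∃ l : List ℕ, l.Sublist (matrixWord x N m) ∧ IncrWord l ∧ l.length = r} =
      growth x m N 0 := by
  have mem_le : ∀ (m : ℕ), ∀ a ∈ matrixWord x N m, a ≤ N := by
    intro m a ha
    induction m with
    | zero => simp [matrixWord] at ha
    | succ m ih =>
      rcases List.mem_append.1 ha with h | h
      · exact ih h
      · exact (mem_rowWord h).2
  refine IsGreatest.csSup_eq ⟨?_, ?_⟩
  · obtain ⟨l, h1, h2, -, h3⟩ := exists_sublist_length_eq_growth hx m (le_refl N)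
    exact ⟨l, h1, (incrWord_iff_pairwise l).2 h2, h3⟩
  · rintro r ⟨l, h1, h2, rfl⟩
    exact length_le_growth hx m le_rfl h1 ((incrWord_iff_pairwise l).1 h2)
      fun a ha => mem_le m a (h1.subset ha)

end FirstRow

/-! ### Matrices of letters as matrices of multiplicities -/

/-- The number of marked letters of an entry: `0` or `1`. -/
def PEnt.markedPart (a : PEnt) : ℕ := if a.isMarked then 1 else 0

/-- The number of unmarked copies of the letter of its column in the word of an entry. -/
def PEnt.unmarkedPart (a : PEnt) : ℕ := a.abs - a.markedPart

/-- The entry with the given numbers of marked and unmarked letters. -/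
def PEnt.ofParts (b r : ℕ) : PEnt :=
  if b = 0 then if h : r = 0 then .zero else .letter ⟨r, Nat.pos_of_ne_zero h⟩ false
  else .letter ⟨r + 1, Nat.succ_pos r⟩ true

theorem PEnt.markedPart_add_unmarkedPart (a : PEnt) :
    a.markedPart + a.unmarkedPart = a.abs := by
  rcases a with _ | ⟨k, _ | _⟩
  · rfl
  · simp [markedPart, unmarkedPart, isMarked]
  · have := k.pos
    simp only [markedPart, unmarkedPart, isMarked, abs, if_true]
    omega

theorem PEnt.markedPart_le_one (a : PEnt) : a.markedPart ≤ 1 := by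
  unfold markedPart
  split_ifs <;> omega

theorem PEnt.ext_parts {a b : PEnt} (h1 : a.markedPart = b.markedPart)
    (h2 : a.unmarkedPart = b.unmarkedPart) : a = b := by
  have h3 := a.markedPart_add_unmarkedPart
  rw [h1, h2, b.markedPart_add_unmarkedPart] at h3
  rcases a with _ | ⟨k, _ | _⟩ <;> rcases b with _ | ⟨l, _ | _⟩ <;>
    simp_all [markedPart, isMarked, abs]
  exact k.ne_zero h3.symm

theorem PEnt.markedPart_ofParts {b r : ℕ} (hb : b ≤ 1) : (ofParts b r).markedPart = b := by
  unfold ofParts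
  split_ifs <;> simp [markedPart, isMarked] <;> omega

theorem PEnt.unmarkedPart_ofParts {b r : ℕ} : (ofParts b r).unmarkedPart = r := by
  unfold ofParts
  split_ifs <;> simp [unmarkedPart, markedPart, isMarked, abs, *]

theorem PEnt.cellCodes_eq (a : PEnt) (j : ℕ) :
    cellCodes a (j + 1) = List.replicate a.markedPart (2 * j + 1) ++
      List.replicate a.unmarkedPart (2 * j + 2) := by
  rcases a with _ | ⟨k, _ | _⟩
  · rfl
  · simp [cellCodes, markedPart, unmarkedPart, isMarked, abs, mul_add]
  · simp [cellCodes, markedPart, unmarkedPart, isMarked, abs, mul_add]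

section Multiplicities

variable {m n : ℕ}

/-- The number of letters with code `c + 1` in row `i` of a matrix of letters. -/
def letterCount (A : Fin m → Fin n → PEnt) (i c : ℕ) : ℕ :=
  if h : i < m ∧ c / 2 < n then
    if markedCol c then (A ⟨i, h.1⟩ ⟨c / 2, h.2⟩).markedPart
    else (A ⟨i, h.1⟩ ⟨c / 2, h.2⟩).unmarkedPart
  else 0

theorem letterCount_two_mul (A : Fin m → Fin n → PEnt) (i : Fin m) (j : Fin n) :
    letterCount A i (2 * j) = (A i j).markedPart := by
  simp [letterCount, markedCol]

theorem letterCount_two_mul_add_one (A : Fin m → Fin n → PEnt) (i : Fin m) (j : Fin n) :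
    letterCount A i (2 * j + 1) = (A i j).unmarkedPart := by
  have h : (2 * (j : ℕ) + 1) / 2 = j := by omega
  simp [letterCount, markedCol, h]

theorem isValid_letterCount (A : Fin m → Fin n → PEnt) : IsValid (letterCount A) := by
  intro i c hc
  unfold letterCount
  split_ifs
  · exact PEnt.markedPart_le_one _
  · exact Nat.zero_le _

theorem sum_range_two_mul (y : ℕ → ℕ) (n : ℕ) :
    ∑ c ∈ Finset.range (2 * n), y c = ∑ j ∈ Finset.range n, (y (2 * j) + y (2 * j + 1)) := by
  induction n with
  | zero => rfl
  | succ n ih =>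
    rw [Nat.mul_succ, Finset.sum_range_succ, Finset.sum_range_succ, ih, Finset.sum_range_succ,
      add_assoc]

theorem rowWord_two_mul (y : ℕ → ℕ) (n : ℕ) :
    rowWord y (2 * n) = (List.range n).flatMap fun j =>
      List.replicate (y (2 * j)) (2 * j + 1) ++ List.replicate (y (2 * j + 1)) (2 * j + 2) := by
  induction n with
  | zero => rfl
  | succ n ih =>
    rw [Nat.mul_succ, rowWord, rowWord, ih, List.range_succ, List.flatMap_append]
    simp

theorem matrixWord_eq_flatMap (x : ℕ → ℕ → ℕ) (N i : ℕ) :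
    matrixWord x N i = (List.range i).flatMap fun r => rowWord (x r) N := by
  induction i with
  | zero => rfl
  | succ i ih =>
    rw [matrixWord, ih, List.range_succ, List.flatMap_append]
    simp

theorem flatMap_finRange {α : Type*} (k : ℕ) (F : ℕ → List α) :
    ((List.finRange k).flatMap fun i : Fin k => F i) = (List.range k).flatMap F := by
  rw [← List.map_coe_finRange_eq_range, List.flatMap_map]

theorem lowerWord_eq_matrixWord (A : Fin m → Fin n → PEnt) :
    lowerWord A = matrixWord (letterCount A) (2 * n) m := by
  rw [matrixWord_eq_flatMap, ← flatMap_finRange, lowerWord]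
  congr 1
  funext i
  rw [rowWord_two_mul, ← flatMap_finRange]
  congr 1
  funext j
  rw [PEnt.cellCodes_eq, letterCount_two_mul, letterCount_two_mul_add_one]

end Multiplicities

/-! ### The correspondence -/

/-- The doubling of a chain of horizontal strips, in which only unmarked letters occur. -/
theorem isShapeChain_half {u : ℕ → ℕ → ℕ} (h0 : u 0 = 0)
    (hu : ∀ i, HStrip (u i) (u (i + 1))) : IsShapeChain fun c => u (c / 2) where
  zero := h0
  anti c := (hu (c / 2)).antitone_left
  step c := by
    by_cases hc : c % 2 = 0
    · rw [show markedCol c = true from decide_eq_true hc,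
        show (c + 1) / 2 = c / 2 by omega]
      exact fun k => ⟨le_rfl, Nat.le_succ _⟩
    · rw [show markedCol c = false from decide_eq_false hc,
        show (c + 1) / 2 = c / 2 + 1 by omega]
      exact hu (c / 2)

section Correspondence

variable {m n : ℕ} (A : Fin m → Fin n → PEnt)

theorem isShapeChain_rows (i : ℕ) : IsShapeChain (growth (letterCount A) i) :=
  isShapeChain_growth (isValid_letterCount A) i

theorem isShapeChain_columns :
    IsShapeChain fun c => growth (letterCount A) (c / 2) (2 * n) :=
  isShapeChain_half (u := fun i => growth (letterCount A) i (2 * n)) rfl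
    fun i => hStrip_growth (isValid_letterCount A) i (2 * n)

/-- The common shape of the tableaux corresponding to a matrix. -/
def rskShape : YoungDiagram :=
  diagram (growth (letterCount A) m (2 * n)) ((isShapeChain_rows A m).anti _) m

theorem mem_rskShape (i j : ℕ) :
    (i, j) ∈ rskShape A ↔ j < growth (letterCount A) m (2 * n) i :=
  mem_diagram fun _ hk => growth_eq_zero (isValid_letterCount A) _ hk

theorem mem_rskShape_half (i j : ℕ) :
    (i, j) ∈ rskShape A ↔ j < growth (letterCount A) (2 * m / 2) (2 * n) i := by
  rw [mem_rskShape, Nat.mul_div_cancel_left m two_pos]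

/-- The tableau of letters corresponding to a matrix. -/
noncomputable def rskS : MarkedTableau (rskShape A) :=
  .ofChain _ _ (isShapeChain_rows A m) (2 * n) (mem_rskShape A)

/-- The tableau of row indices corresponding to a matrix. -/
noncomputable def rskU : MarkedTableau (rskShape A) :=
  .ofChain _ _ (isShapeChain_columns A) (2 * m) (mem_rskShape_half A)

theorem rskS_val_le {i j : ℕ} (h : (i, j) ∈ rskShape A) : (rskS A).val i j ≤ 2 * n :=
  (MarkedTableau.ofChain_val_le_iff h).2 ((mem_rskShape A i j).1 h)

theorem rskU_val_le {i j : ℕ} (h : (i, j) ∈ rskShape A) : (rskU A).val i j ≤ 2 * m :=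
  (MarkedTableau.ofChain_val_le_iff h).2 ((mem_rskShape_half A i j).1 h)

theorem rskU_val_even {i j : ℕ} (h : (i, j) ∈ rskShape A) : (rskU A).val i j % 2 = 0 := by
  by_contra hodd
  have h1 := (MarkedTableau.ofChain_val_le_iff (hf := isShapeChain_columns A)
    (hμ := mem_rskShape_half A) h).1 le_rfl
  have h2 := (MarkedTableau.ofChain_val_le_iff (hf := isShapeChain_columns A)
    (hμ := mem_rskShape_half A) (c := (rskU A).val i j - 1) h).2
  change j < growth (letterCount A) ((rskU A).val i j / 2) (2 * n) i at h1
  rw [show ((rskU A).val i j - 1) / 2 = (rskU A).val i j / 2 by omega] at h2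
  have h3 : (rskU A).val i j ≤ (rskU A).val i j - 1 := h2 h1
  omega

/-- The pair of tableaux corresponding to a matrix. -/
noncomputable def rskPair : RSKPair m n where
  shape := rskShape A
  S := rskS A
  U := rskU A
  hS _ _ := rskS_val_le A
  hU _ _ h := ⟨rskU_val_even A h, rskU_val_le A h⟩

theorem toChain_rskS {c : ℕ} (hc : c ≤ 2 * n) :
    (rskS A).toChain c = growth (letterCount A) m c :=
  MarkedTableau.toChain_ofChain hc

theorem toChain_rskU {i : ℕ} (hi : i ≤ m) :
    (rskU A).toChain (2 * i) = growth (letterCount A) i (2 * n) := by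
  have h := MarkedTableau.toChain_ofChain (hf := isShapeChain_columns A)
    (hμ := mem_rskShape_half A) (show 2 * i ≤ 2 * m by omega)
  rwa [Nat.mul_div_cancel_left i two_pos] at h

theorem card_rskS_val_eq {c : ℕ} (hc : c < 2 * n) :
    ((rskShape A).cells.filter fun p => (rskS A).val p.1 p.2 = c + 1).card =
      ∑ i ∈ Finset.range m, letterCount A i c := by
  have hK : ∀ d ≤ 2 * n, ∀ k, m ≤ k → (rskS A).toChain d k = 0 := fun d hd k hk => by
    rw [toChain_rskS A hd]
    exact growth_eq_zero (isValid_letterCount A) d hk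
  have h := (rskS A).card_val_le_add_card_val_eq c
  rw [(rskS A).card_val_le c (hK c hc.le), (rskS A).card_val_le (c + 1) (hK (c + 1) hc),
    toChain_rskS A hc.le, toChain_rskS A hc, sum_growth (isValid_letterCount A) le_rfl,
    sum_growth (isValid_letterCount A) le_rfl] at h
  simp only [Finset.sum_range_succ, Finset.sum_add_distrib] at h
  omega

theorem mcount_rskS (j : Fin n) : mcount (rskS A) (j + 1) = ∑ i, (A i j).abs := by
  have hj := j.isLt
  rw [MarkedTableau.mcount_succ, card_rskS_val_eq A (by omega),
    card_rskS_val_eq A (by omega : 2 * (j : ℕ) + 1 < 2 * n), ← Finset.sum_add_distrib,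
    Finset.sum_range]
  refine Finset.sum_congr rfl fun i _ => ?_
  rw [letterCount_two_mul, letterCount_two_mul_add_one, PEnt.markedPart_add_unmarkedPart]

theorem mcount_rskU (i : Fin m) : mcount (rskU A) (i + 1) = ∑ j, (A i j).abs := by
  have hi := i.isLt
  have hK : ∀ d ≤ m, ∀ k, m ≤ k → (rskU A).toChain (2 * d) k = 0 := fun d hd k hk => by
    rw [toChain_rskU A hd]
    exact growth_eq_zero (isValid_letterCount A) _ (hd.trans hk)
  have h1 := (rskU A).card_val_le_add_card_val_eq (2 * i)
  have h2 := (rskU A).card_val_le_add_card_val_eq (2 * i + 1)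
  have h3 := (rskU A).card_val_le _ (hK (i + 1) hi)
  rw [toChain_rskU A hi, sum_growth (isValid_letterCount A) hi, Finset.sum_range_succ] at h3
  have h4 := (rskU A).card_val_le _ (hK i hi.le)
  rw [toChain_rskU A hi.le, sum_growth (isValid_letterCount A) hi.le] at h4
  have h5 : ∑ c ∈ Finset.range (2 * n), letterCount A i c = ∑ j, (A i j).abs := by
    rw [sum_range_two_mul, Finset.sum_range]
    refine Finset.sum_congr rfl fun j _ => ?_
    rw [letterCount_two_mul, letterCount_two_mul_add_one, PEnt.markedPart_add_unmarkedPart]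
  rw [MarkedTableau.mcount_succ]
  rw [show 2 * ((i : ℕ) + 1) = 2 * i + 1 + 1 from rfl] at h3
  omega

theorem markTab_rskS : markTab (rskS A) = markMatrix A := by
  have h : markMatrix A = ∑ i : Fin m, ∑ j : Fin n, (A i j).markedPart := by
    rw [markMatrix, Finset.card_filter, Fintype.sum_prod_type]
    rfl
  rw [h, Finset.sum_comm, (rskS A).markTab_eq_sum fun _ _ => rskS_val_le A, Finset.sum_range]
  refine Finset.sum_congr rfl fun j _ => ?_
  have hj := j.isLt
  rw [card_rskS_val_eq A (by omega), Finset.sum_range]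
  exact Finset.sum_congr rfl fun i _ => letterCount_two_mul A i j

theorem ellMatrix_eq_rowLen : ellMatrix A = (rskShape A).rowLen 0 := by
  rw [ellMatrix, lowerWord_eq_matrixWord, sSup_length_eq_growth (isValid_letterCount A)]
  refine eq_of_forall_lt_iff fun j => ?_
  rw [← mem_rskShape, YoungDiagram.mem_iff_lt_rowLen]

theorem rskPair_injective : Function.Injective (rskPair : (Fin m → Fin n → PEnt) → _) := by
  intro A B h
  have key : ∀ P Q : RSKPair m n, P = Q → P.S.toChain = Q.S.toChain ∧
      P.U.toChain = Q.U.toChain := by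
    rintro P _ rfl
    exact ⟨rfl, rfl⟩
  obtain ⟨hS, hU⟩ : (rskS A).toChain = (rskS B).toChain ∧
      (rskU A).toChain = (rskU B).toChain := key _ _ h
  have hmul := growth_injective (isValid_letterCount A) (isValid_letterCount B) (M := m)
    (N := 2 * n) (fun c hc => by rw [← toChain_rskS A hc, ← toChain_rskS B hc, hS])
    (fun i hi => by rw [← toChain_rskU A hi, ← toChain_rskU B hi, hU])
  funext i j
  have hj := j.isLt
  apply PEnt.ext_parts
  · rw [← letterCount_two_mul, ← letterCount_two_mul]
    exact hmul i i.isLt _ (by omega)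
  · rw [← letterCount_two_mul_add_one, ← letterCount_two_mul_add_one]
    exact hmul i i.isLt _ (by omega)

theorem growth_congr_of_le {x y : ℕ → ℕ → ℕ} {M N : ℕ}
    (h : ∀ i < M, ∀ c < N, x i c = y i c) :
    ∀ i ≤ M, ∀ c ≤ N, growth x i c = growth y i c := by
  intro i hi
  induction i with
  | zero => exact fun _ _ => rfl
  | succ i ih =>
    intro c hc
    induction c with
    | zero => rfl
    | succ c ihc =>
      change localRule _ _ _ (growth x (i + 1) c) _ = localRule _ _ _ (growth y (i + 1) c) _
      rw [ihc (by omega), ih (by omega) c (by omega), ih (by omega) (c + 1) hc,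
        h i hi c hc]

theorem rskPair_surjective : Function.Surjective (rskPair : (Fin m → Fin n → PEnt) → _) := by
  rintro ⟨μ, S, U, hS, hU⟩
  have hUstep : ∀ i, U.toChain (2 * i + 1) = U.toChain (2 * i) := fun i => by
    funext k
    refine eq_of_forall_lt_iff fun j => ?_
    rw [U.lt_toChain_iff, U.lt_toChain_iff]
    refine and_congr_right fun h => ?_
    have := (hU k j h).1
    omega
  obtain ⟨x, hx, hxS, hxU⟩ := growth_surjective (M := m) (N := 2 * n) (s := S.toChain)
    (u := fun i => U.toChain (2 * i)) S.isShapeChain_toChain U.isShapeChain_toChain.zero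
    (fun i _ => by
      have h := U.isShapeChain_toChain.step (2 * i + 1)
      rw [show markedCol (2 * i + 1) = false from decide_eq_false (by omega), hUstep] at h
      exact h)
    (by
      funext k
      rw [S.toChain_eq_rowLen hS, U.toChain_eq_rowLen fun i j h => (hU i j h).2])
  set A : Fin m → Fin n → PEnt := fun i j => PEnt.ofParts (x i (2 * j)) (x i (2 * j + 1))
    with hA
  have hmul : ∀ i < m, ∀ c < 2 * n, letterCount A i c = x i c := by
    intro i hi c hc
    rcases Nat.even_or_odd' c with ⟨j, rfl | rfl⟩
    · rw [letterCount_two_mul A ⟨i, hi⟩ ⟨j, by omega⟩]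
      exact PEnt.markedPart_ofParts (hx i _ (decide_eq_true (by omega)))
    · rw [letterCount_two_mul_add_one A ⟨i, hi⟩ ⟨j, by omega⟩]
      exact PEnt.unmarkedPart_ofParts
  have hg := growth_congr_of_le hmul
  refine ⟨A, RSKPair.ext_val ?_ ?_⟩
  · refine S.val_ofChain_toChain (hf := isShapeChain_rows A m) (hν := mem_rskShape A) hS fun c hc => ?_
    rw [hg m le_rfl c hc, hxS c hc]
  · refine U.val_ofChain_toChain (hf := isShapeChain_columns A) (hν := mem_rskShape_half A)
      (fun i j h => (hU i j h).2) fun c hc => ?_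
    rw [hg (c / 2) (by omega) _ le_rfl, hxU (c / 2) (by omega)]
    rcases Nat.even_or_odd' c with ⟨i, rfl | rfl⟩
    · rw [Nat.mul_div_cancel_left i two_pos]
    · rw [hUstep, show (2 * i + 1) / 2 = i by omega]

end Correspondence

/-- the generalized RSK bijection `A ↦ (S, U)` (with the type, weight and
mark conditions of the RSK correspondence) additionally satisfies `ℓ(A) = λ₁`: the length
of the longest increasing subsequence of the biword `w_A` equals the first part of the
common shape `λ` of `(S, U)`. -/
theorem generalized_RSK_first_row (m n : ℕ) (hm : 0 < m) (hn : 0 < n) :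
    ∃ Φ : (Fin m → Fin n → PEnt) → RSKPair m n,
      Function.Bijective Φ ∧
      ∀ A : Fin m → Fin n → PEnt,
        (∀ j : Fin n, ∑ i : Fin m, (A i j).abs = mcount (Φ A).S ((j : ℕ) + 1)) ∧
        (∀ i : Fin m, ∑ j : Fin n, (A i j).abs = mcount (Φ A).U ((i : ℕ) + 1)) ∧
        markMatrix A = markTab (Φ A).S ∧
        ellMatrix A = (Φ A).shape.rowLen 0 :=
  ⟨rskPair, ⟨rskPair_injective, rskPair_surjective⟩, fun A =>
    ⟨fun j => (mcount_rskS A j).symm, fun i => (mcount_rskU A i).symm, (markTab_rskS A).symm,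
      ellMatrix_eq_rowLen A⟩⟩
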